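/- Weak isomorphism and the unlabeled cut distance: let d be an invariant and smooth distance on the space 𝒲₁ of probability-graphons, and let δ_□(U,W) := inf_{φ∈S_{[0,1]}} d(U, W^φ). Then for all probability-graphons U, W: δ_□(U,W) = 0 if and only if U and W are weakly isomorphic, i.e. there exist measure-preserving maps φ, ψ ∈ S̄_{[0,1]} such that U^φ(x,y;·) = W^ψ(x,y;·) for a.e. (x,y) ∈ [0,1]². Consequently, δ_□ is a distance on the quotient space 𝒲̃₁ of probability-graphons modulo weak isomorphism. -/

import Mathlib

open MeasureTheory Filter Topology
open scoped ENNReal NNReal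

noncomputable section

namespace PG

/-- The unit square `[0,1]²`, with its product Lebesgue measure. -/
abbrev Sq : Type := unitInterval × unitInterval

variable {Z : Type*} [MeasurableSpace Z] [TopologicalSpace Z]

/-! ### Measure-valued kernels and probability-graphons -/

/-- `W(A;·) = ∫_A W(x,y;·) dx dy` for a measure-valued kernel. -/
def kernelInt (W : Sq → Measure Z) (A : Set Sq) : Measure Z :=
  ((volume : Measure Sq).restrict A).bind W

/-- The measure `M_W = W([0,1]²;·)` associated with a (positive) measure-valued kernel. -/
def MW (W : Sq → Measure Z) : Measure Z := (volume : Measure Sq).bind W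

/-- A probability-graphon: a measurable map from `[0,1]²` to probability measures on `Z`. -/
def IsProbGraphon (W : Sq → Measure Z) : Prop :=
  (∀ A : Set Z, MeasurableSet A → Measurable fun p => W p A) ∧
    ∀ p, IsProbabilityMeasure (W p)

/-- Essential supremum of the total mass of a positive measure-valued kernel. -/
def TVboundPos (W : Sq → Measure Z) : ℝ≥0∞ :=
  essSup (fun p => W p Set.univ) (volume : Measure Sq)

/-- A (positive) measure-valued kernel: measurable and essentially bounded. -/
def IsPosKernel (W : Sq → Measure Z) : Prop :=
  (∀ A : Set Z, MeasurableSet A → Measurable fun p => W p A) ∧ TVboundPos W < ⊤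

/-- Relabeling `W^φ` of a kernel by a map `φ : [0,1] → [0,1]`. -/
def relabel (W : Sq → Measure Z) (φ : unitInterval → unitInterval) : Sq → Measure Z :=
  fun p => W (φ p.1, φ p.2)

/-- `φ` is a Lebesgue-measure-preserving map of `[0,1]`. -/
def IsMP (φ : unitInterval → unitInterval) : Prop :=
  MeasurePreserving φ (volume : Measure unitInterval) (volume : Measure unitInterval)

/-- Weak convergence of a sequence of (finite) measures on `Z`. -/
def WeakTendsto (μ : ℕ → Measure Z) (ν : Measure Z) : Prop :=
  ∀ f : BoundedContinuousFunction Z ℝ,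
    Tendsto (fun n => ∫ x, f x ∂(μ n)) atTop (𝓝 (∫ x, f x ∂ν))

/-- The cut distance `d_{□,m}` associated with a distance `d_m` on measures. -/
def cutDist (dm : Measure Z → Measure Z → ℝ) (U W : Sq → Measure Z) : ℝ :=
  ⨆ ST : {p : Set unitInterval × Set unitInterval // MeasurableSet p.1 ∧ MeasurableSet p.2},
    dm (kernelInt U (ST.val.1 ×ˢ ST.val.2)) (kernelInt W (ST.val.1 ×ˢ ST.val.2))

/-- The unlabeled cut distance `δ_□` associated with a distance `d` on kernels:
`δ_□(U,W) = inf_{φ ∈ S_{[0,1]}} d(U, W^φ)`. -/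
def deltaCut (d : (Sq → Measure Z) → (Sq → Measure Z) → ℝ) (U W : Sq → Measure Z) : ℝ :=
  ⨅ φ : {φ : unitInterval → unitInterval // IsMP φ ∧ Function.Bijective φ},
    d U (relabel W φ.val)

/-- Weak isomorphism of kernels: `U^φ = W^ψ` a.e. for some measure-preserving `φ, ψ`. -/
def WeakIso (U W : Sq → Measure Z) : Prop :=
  ∃ φ ψ : unitInterval → unitInterval, IsMP φ ∧ IsMP ψ ∧
    relabel U φ =ᵐ[(volume : Measure Sq)] relabel W ψ

/-- A family of kernels is tight if the family of measures `{M_W}` is tight. -/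
def TightFamily (K : Set (Sq → Measure Z)) : Prop :=
  ∀ ε : ℝ≥0∞, 0 < ε → ∃ K₀ : Set Z, IsCompact K₀ ∧ ∀ W ∈ K, MW W K₀ᶜ ≤ ε

/-- Invariance of a distance on probability-graphons under bijective
measure-preserving relabelings. -/
def Invariant (d : (Sq → Measure Z) → (Sq → Measure Z) → ℝ) : Prop :=
  ∀ U W : Sq → Measure Z, IsProbGraphon U → IsProbGraphon W →
    ∀ φ : unitInterval → unitInterval, IsMP φ → Function.Bijective φ →
      d (relabel U φ) (relabel W φ) = d U W

/-- Smoothness of a distance on probability-graphons: a.e. weak convergence implies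
convergence in `d`. -/
def Smooth (d : (Sq → Measure Z) → (Sq → Measure Z) → ℝ) : Prop :=
  ∀ (Wn : ℕ → Sq → Measure Z) (W : Sq → Measure Z),
    (∀ n, IsProbGraphon (Wn n)) → IsProbGraphon W →
    (∀ᵐ p ∂(volume : Measure Sq), WeakTendsto (fun n => Wn n p) (W p)) →
    Tendsto (fun n => d (Wn n) W) atTop (𝓝 0)

/-- `d` is a distance on the space `𝒲₁` of probability-graphons (where kernels that
agree a.e. are identified). -/
def IsGraphonDist (d : (Sq → Measure Z) → (Sq → Measure Z) → ℝ) : Prop :=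
  (∀ U W, IsProbGraphon U → IsProbGraphon W → d U W = d W U) ∧
  (∀ U W, IsProbGraphon U → IsProbGraphon W → 0 ≤ d U W) ∧
  (∀ U V W, IsProbGraphon U → IsProbGraphon V → IsProbGraphon W → d U W ≤ d U V + d V W) ∧
  (∀ U W, IsProbGraphon U → IsProbGraphon W →
    (d U W = 0 ↔ U =ᵐ[(volume : Measure Sq)] W))

/-- Distance axioms for `d` on a subset `M`. -/
def IsDistOnSet {α : Type*} (M : Set α) (d : α → α → ℝ) : Prop :=
  (∀ x ∈ M, ∀ y ∈ M, d x y = d y x) ∧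
  (∀ x ∈ M, ∀ y ∈ M, 0 ≤ d x y) ∧
  (∀ x ∈ M, ∀ y ∈ M, ∀ z ∈ M, d x z ≤ d x y + d y z) ∧
  (∀ x ∈ M, ∀ y ∈ M, (d x y = 0 ↔ x = y))

/-- The set `ℳ≤1(Z)` of measures of total mass at most one. -/
def SubProb (Z : Type*) [MeasurableSpace Z] : Set (Measure Z) := {μ | μ Set.univ ≤ 1}

/-- `d_m` is a distance on `ℳ≤1(Z)`. -/
def IsDistOnSubProb (dm : Measure Z → Measure Z → ℝ) : Prop :=
  IsDistOnSet (SubProb Z) dm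

/-- `d_m` induces the weak topology on `ℳ≤1(Z)` (sequential formulation; the weak
topology on `ℳ≤1(Z)` is metrizable, so it is characterized by its convergent
sequences). -/
def InducesWeakTopologySub (dm : Measure Z → Measure Z → ℝ) : Prop :=
  ∀ (μn : ℕ → Measure Z) (μ : Measure Z), (∀ n, μn n ∈ SubProb Z) → μ ∈ SubProb Z →
    (Tendsto (fun n => dm (μn n) μ) atTop (𝓝 0) ↔ WeakTendsto μn μ)

/-- Quasi-convexity of a distance on the convex set `ℳ₊(Z)` of finite measures. -/
def QuasiConvexPos (dm : Measure Z → Measure Z → ℝ) : Prop :=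
  ∀ μ₁ μ₂ ν₁ ν₂ : Measure Z, IsFiniteMeasure μ₁ → IsFiniteMeasure μ₂ →
    IsFiniteMeasure ν₁ → IsFiniteMeasure ν₂ → ∀ a : ℝ≥0∞, a ≤ 1 →
    dm (a • μ₁ + (1 - a) • μ₂) (a • ν₁ + (1 - a) • ν₂) ≤ max (dm μ₁ ν₁) (dm μ₂ ν₂)

/-! ### Finite partitions of `[0,1]` and the stepping operator -/

/-- A finite measurable partition of `[0,1]` (possibly with empty classes). -/
structure FinPartition : Type where
  n : ℕ
  part : Fin n → Set unitInterval
  measurableSet : ∀ i, MeasurableSet (part i)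
  disjoint : ∀ i j, i ≠ j → Disjoint (part i) (part j)
  covers : (⋃ i, part i) = Set.univ

/-- `P` refines `Q`: every class of `P` is included in a class of `Q`. -/
def FinPartition.Refines (P Q : FinPartition) : Prop :=
  ∀ i, ∃ j, P.part i ⊆ Q.part j

/-- The stepping `W_𝒫` of a (positive) measure-valued kernel `W` with respect to a
finite partition `𝒫`: on `S_i × S_j` it equals `W(S_i×S_j;·)/(λ(S_i)λ(S_j))`
(and the zero measure on classes of zero measure). -/
def stepping (W : Sq → Measure Z) (P : FinPartition) : Sq → Measure Z :=
  fun p => ∑ i : Fin P.n, ∑ j : Fin P.n,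
    Set.indicator (P.part i ×ˢ P.part j)
      (fun _ => ((volume (P.part i)) * (volume (P.part j)))⁻¹ •
        kernelInt W (P.part i ×ˢ P.part j)) p

/-- Weak regularity of a distance on probability-graphons. -/
def WeaklyRegular (d : (Sq → Measure Z) → (Sq → Measure Z) → ℝ) : Prop :=
  ∀ K : Set (Sq → Measure Z), (∀ W ∈ K, IsProbGraphon W) → TightFamily K →
    ∀ ε : ℝ, 0 < ε → ∃ m : ℕ, 0 < m ∧
      ∀ W ∈ K, ∀ Q : FinPartition, ∃ P : FinPartition,
        P.Refines Q ∧ P.n ≤ m * Q.n ∧ d W (stepping W P) < ε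

/-- Regularity of a distance on probability-graphons with respect to the stepping
operator. -/
def SteppingRegular (d : (Sq → Measure Z) → (Sq → Measure Z) → ℝ) : Prop :=
  ∃ C₀ : ℝ, 0 < C₀ ∧ ∀ W U : Sq → Measure Z, IsProbGraphon W → IsProbGraphon U →
    ∀ P : FinPartition, d W (stepping W P) ≤ C₀ * d W (stepping U P)

/-! ### Signed measure-valued kernels -/

/-- The signed measure associated with a finite measure (and junk value `0` on
non-finite measures). -/
def toSigned (μ : Measure Z) : SignedMeasure Z :=
  letI := Classical.dec (IsFiniteMeasure μ)
  if h : IsFiniteMeasure μ then @Measure.toSignedMeasure Z _ μ h else 0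

/-- `W(A;·)` for a signed measure-valued kernel. -/
def skernelInt (W : Sq → SignedMeasure Z) (A : Set Sq) : SignedMeasure Z :=
  toSigned (((volume : Measure Sq).restrict A).bind
      fun p => (W p).toJordanDecomposition.posPart)
    - toSigned (((volume : Measure Sq).restrict A).bind
      fun p => (W p).toJordanDecomposition.negPart)

/-- Total mass `‖s‖_TV` of the total variation of a signed measure. -/
def TVnorm (s : SignedMeasure Z) : ℝ≥0∞ := s.totalVariation Set.univ

/-- `‖W‖∞`, the essential supremum of the total variation masses of a signed
measure-valued kernel. -/
def TVbound (W : Sq → SignedMeasure Z) : ℝ≥0∞ :=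
  essSup (fun p => TVnorm (W p)) (volume : Measure Sq)

/-- A signed measure-valued kernel: measurable in `(x,y)` and essentially bounded in
total variation. -/
def IsSignedKernel (W : Sq → SignedMeasure Z) : Prop :=
  (∀ A : Set Z, MeasurableSet A → Measurable fun p => W p A) ∧ TVbound W < ⊤

/-- The measure `M_W = ∫ |W|(x,y;·) dx dy` of a signed measure-valued kernel. -/
def MWs (W : Sq → SignedMeasure Z) : Measure Z :=
  (volume : Measure Sq).bind fun p => (W p).totalVariation

/-- Tightness for a family of signed measure-valued kernels. -/
def TightFamilyS (K : Set (Sq → SignedMeasure Z)) : Prop :=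
  ∀ ε : ℝ≥0∞, 0 < ε → ∃ K₀ : Set Z, IsCompact K₀ ∧ ∀ W ∈ K, MWs W K₀ᶜ ≤ ε

/-- Integral of a bounded continuous function against a signed measure. -/
def sint (f : BoundedContinuousFunction Z ℝ) (s : SignedMeasure Z) : ℝ :=
  ∫ x, f x ∂s.toJordanDecomposition.posPart - ∫ x, f x ∂s.toJordanDecomposition.negPart

/-- Weak convergence of signed measures. -/
def WeakTendstoS (s : ℕ → SignedMeasure Z) (t : SignedMeasure Z) : Prop :=
  ∀ f : BoundedContinuousFunction Z ℝ,
    Tendsto (fun n => sint f (s n)) atTop (𝓝 (sint f t))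

/-- Stepping of a signed measure-valued kernel with respect to a finite partition. -/
def steppingS (W : Sq → SignedMeasure Z) (P : FinPartition) : Sq → SignedMeasure Z :=
  fun p => ∑ i : Fin P.n, ∑ j : Fin P.n,
    Set.indicator (P.part i ×ˢ P.part j)
      (fun _ => (((volume (P.part i)).toReal * (volume (P.part j)).toReal)⁻¹ : ℝ) •
        skernelInt W (P.part i ×ˢ P.part j)) p

/-- Cut distance for signed measure-valued kernels associated with a distance `d_m`
on signed measures. -/
def cutDistS (dm : SignedMeasure Z → SignedMeasure Z → ℝ) (U W : Sq → SignedMeasure Z) : ℝ :=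
  ⨆ ST : {p : Set unitInterval × Set unitInterval // MeasurableSet p.1 ∧ MeasurableSet p.2},
    dm (skernelInt U (ST.val.1 ×ˢ ST.val.2)) (skernelInt W (ST.val.1 ×ˢ ST.val.2))

/-- Quasi-convexity of a distance on a convex subset `M` of signed measures. -/
def QuasiConvexOn (M : Set (SignedMeasure Z)) (dm : SignedMeasure Z → SignedMeasure Z → ℝ) :
    Prop :=
  ∀ x₁ ∈ M, ∀ x₂ ∈ M, ∀ y₁ ∈ M, ∀ y₂ ∈ M, ∀ a : ℝ, 0 ≤ a → a ≤ 1 →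
    dm (a • x₁ + (1 - a) • x₂) (a • y₁ + (1 - a) • y₂) ≤ max (dm x₁ y₁) (dm x₂ y₂)

/-! ### Convergence determining sequences and the associated norms -/

/-- `F` is a convergence determining sequence: `[0,1]`-valued bounded continuous
functions, `F 0 = 1`, such that convergence of all moments `μ(f_k)` implies weak
convergence (for finite positive measures). -/
def IsConvDet (F : ℕ → BoundedContinuousFunction Z ℝ) : Prop :=
  F 0 = 1 ∧ (∀ k x, F k x ∈ Set.Icc (0:ℝ) 1) ∧
  ∀ (μn : ℕ → Measure Z) (μ : Measure Z), (∀ n, IsFiniteMeasure (μn n)) → IsFiniteMeasure μ →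
    (∀ k, Tendsto (fun n => ∫ x, F k x ∂(μn n)) atTop (𝓝 (∫ x, F k x ∂μ))) →
    WeakTendsto μn μ

/-- `‖μ − ν‖_F = Σ_k 2^{-k} |μ(f_k) − ν(f_k)|` for positive measures. -/
def Fdist (F : ℕ → BoundedContinuousFunction Z ℝ) (μ ν : Measure Z) : ℝ :=
  ∑' k : ℕ, (1/2 : ℝ) ^ k * |∫ x, F k x ∂μ - ∫ x, F k x ∂ν|

/-- The cut distance `d_{□,F}(U,W) = ‖U − W‖_{□,F}` on measure-valued kernels. -/
def cutDistF (F : ℕ → BoundedContinuousFunction Z ℝ) (U W : Sq → Measure Z) : ℝ :=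
  ⨆ ST : {p : Set unitInterval × Set unitInterval // MeasurableSet p.1 ∧ MeasurableSet p.2},
    Fdist F (kernelInt U (ST.val.1 ×ˢ ST.val.2)) (kernelInt W (ST.val.1 ×ˢ ST.val.2))

/-- The norm `‖s‖_F` of a signed measure. -/
def FnormS (F : ℕ → BoundedContinuousFunction Z ℝ) (s : SignedMeasure Z) : ℝ :=
  ∑' k : ℕ, (1/2 : ℝ) ^ k * |sint (F k) s|

/-- The cut norm `‖W‖_{□,F}` of a signed measure-valued kernel. -/
def cutNormFS (F : ℕ → BoundedContinuousFunction Z ℝ) (W : Sq → SignedMeasure Z) : ℝ :=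
  ⨆ ST : {p : Set unitInterval × Set unitInterval // MeasurableSet p.1 ∧ MeasurableSet p.2},
    FnormS F (skernelInt W (ST.val.1 ×ˢ ST.val.2))

/-- The norm `‖W‖_{2,F}` of a signed measure-valued kernel. -/
def norm2F (F : ℕ → BoundedContinuousFunction Z ℝ) (W : Sq → SignedMeasure Z) : ℝ :=
  Real.sqrt (∑' k : ℕ, (1/2 : ℝ) ^ k * ∫ p, (sint (F k) (W p)) ^ 2 ∂(volume : Measure Sq))

/-! ### Homomorphism densities and sampling -/

/-- The homomorphism density `t(F^g, W)` of a `C_b(Z)`-decorated finite directed graph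
with vertex set `Fin v` and edge set `E` in a measure-valued kernel `W`. -/
def homDensity {v : ℕ} (E : Finset (Fin v × Fin v))
    (g : Fin v × Fin v → BoundedContinuousFunction Z ℝ) (W : Sq → Measure Z) : ℝ :=
  ∫ x : Fin v → unitInterval,
    (∏ e ∈ E, ∫ z, g e z ∂(W (x e.1, x e.2))) ∂(volume : Measure (Fin v → unitInterval))

/-- The edge set of the complete directed graph on `k` vertices. -/
def completeEdges (k : ℕ) : Finset (Fin k × Fin k) :=
  Finset.univ.filter fun e => e.1 ≠ e.2

/-- The `i`-th step `((i)/k, (i+1)/k]` of the uniform partition of `[0,1]` into `k`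
intervals. -/
def stepSet (k : ℕ) (i : Fin k) : Set unitInterval :=
  {t | (i : ℝ) / k < (t : ℝ) ∧ (t : ℝ) ≤ ((i : ℝ) + 1) / k}

/-- The stepfunction `W_x` sampled from `W` at the points `x = (x₁, …, x_k)`. -/
def sample (W : Sq → Measure Z) {k : ℕ} (x : Fin k → unitInterval) : Sq → Measure Z :=
  fun p => ∑ i : Fin k, ∑ j : Fin k,
    Set.indicator (stepSet k i ×ˢ stepSet k j) (fun _ => W (x i, x j)) p

/-- The probability-graphon associated with the `Z`-weighted complete graph on `k`
vertices with weights `β`. -/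
def graphonOfWeights {k : ℕ} (β : Fin k × Fin k → Z) : Sq → Measure Z :=
  fun p => ∑ i : Fin k, ∑ j : Fin k,
    Set.indicator (stepSet k i ×ˢ stepSet k j) (fun _ => Measure.dirac (β (i, j))) p

/-- The joint law of `(X, (β_{ij}))` where `X` is uniform on `[0,1]^k` and, given `X`,
the weights `β_{ij}` are independent with respective laws `W(X_i, X_j;·)`. -/
def sampleLaw (W : Sq → Measure Z) (k : ℕ) :
    Measure ((Fin k → unitInterval) × (Fin k × Fin k → Z)) :=
  (volume : Measure (Fin k → unitInterval)).bind fun x =>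
    (Measure.pi fun e : Fin k × Fin k => W (x e.1, x e.2)).map (Prod.mk x)

/-! ### Interval exchanges -/

/-- The map of `ℝ` which permutes the intervals `[k/N, (k+1)/N)` by translations according
to `τ`. -/
def intervalExchange (N : ℕ) (τ : Equiv.Perm ℤ) (y : ℝ) : ℝ :=
  y + ((τ ⌊N * y⌋ : ℝ) - ⌊N * y⌋) / N

lemma floor_intervalExchange {N : ℕ} (hN : 0 < N) (τ : Equiv.Perm ℤ) (y : ℝ) :
    ⌊N * intervalExchange N τ y⌋ = τ ⌊N * y⌋ := by
  have hN' : (N : ℝ) ≠ 0 := by positivity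
  have : N * intervalExchange N τ y = N * y + ((τ ⌊N * y⌋ - ⌊N * y⌋ : ℤ) : ℝ) := by
    unfold intervalExchange
    push_cast
    field_simp
  rw [this, Int.floor_add_intCast]
  ring

lemma intervalExchange_symm {N : ℕ} (hN : 0 < N) (τ : Equiv.Perm ℤ) (y : ℝ) :
    intervalExchange N τ.symm (intervalExchange N τ y) = y := by
  rw [intervalExchange, floor_intervalExchange hN, Equiv.symm_apply_apply, intervalExchange]
  ring

lemma measurable_intervalExchange (N : ℕ) (τ : Equiv.Perm ℤ) :
    Measurable (intervalExchange N τ) := by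
  have h : Measurable fun y : ℝ => ⌊N * y⌋ := Int.measurable_floor.comp (by fun_prop)
  have h1 : Measurable fun k : ℤ => (k : ℝ) := measurable_from_top
  have h2 : Measurable fun k : ℤ => (τ k : ℝ) := measurable_from_top
  exact measurable_id.add (((h2.comp h).sub (h1.comp h)).div_const _)

lemma measurePreserving_intervalExchange {N : ℕ} (hN : 0 < N) (τ : Equiv.Perm ℤ) :
    MeasurePreserving (intervalExchange N τ) := by
  have hN' : (N : ℝ) ≠ 0 := by positivity
  have hm := measurable_intervalExchange N τ
  have hfl : Measurable fun y : ℝ => ⌊N * y⌋ := Int.measurable_floor.comp (by fun_prop)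
  refine ⟨hm, Measure.ext fun A hA => ?_⟩
  rw [Measure.map_apply hm hA]
  have key : ∀ B : Set ℝ, MeasurableSet B →
      volume B = ∑' k : ℤ, volume (B ∩ (fun y : ℝ => ⌊N * y⌋) ⁻¹' {k}) := by
    intro B hB
    rw [← measure_iUnion]
    · congr 1
      ext y
      simp
    · intro i j hij
      refine Set.disjoint_left.2 fun y hy hy' => hij ?_
      exact hy.2.symm.trans hy'.2
    · exact fun k => hB.inter (hfl (measurableSet_singleton k))
  rw [key _ (hm hA), key A hA, ← τ.tsum_eq fun k => volume (A ∩ _)]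
  congr 1
  ext k
  rw [← measure_preimage_add_right volume (((τ k : ℝ) - k) / N) (A ∩ _)]
  congr 1
  ext y
  have hy : (N : ℝ) * (y + ((τ k : ℝ) - k) / N) = N * y + ((τ k - k : ℤ) : ℝ) := by
    push_cast
    field_simp
  simp only [Set.mem_inter_iff, Set.mem_preimage, Set.mem_singleton_iff, hy,
    Int.floor_add_intCast]
  constructor
  · rintro ⟨h1, h2⟩
    refine ⟨?_, by omega⟩
    simpa only [intervalExchange, h2] using h1
  · rintro ⟨h1, h2⟩
    have h3 : ⌊N * y⌋ = k := by omega
    refine ⟨?_, h3⟩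
    simpa only [intervalExchange, h3] using h1

lemma intervalExchange_mem_Icc {N : ℕ} (hN : 0 < N) {τ : Equiv.Perm ℤ}
    (hτ : ∀ k : ℤ, 0 ≤ k → k < N → 0 ≤ τ k ∧ τ k < N) (hτN : τ N = N) {y : ℝ}
    (hy : y ∈ Set.Icc (0 : ℝ) 1) : intervalExchange N τ y ∈ Set.Icc (0 : ℝ) 1 := by
  have hN' : (0 : ℝ) < N := by positivity
  rcases hy.2.eq_or_lt with rfl | h1
  · simp [intervalExchange, hτN]
  · have h0 : 0 ≤ ⌊N * y⌋ := Int.floor_nonneg.2 (mul_nonneg hN'.le hy.1)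
    have h2 : ⌊N * y⌋ < N := Int.floor_lt.2 (by push_cast; nlinarith)
    obtain ⟨h3, h4⟩ := hτ _ h0 h2
    rw [← floor_intervalExchange hN] at h3 h4
    have h5 := Int.floor_nonneg.1 h3
    have h6 := Int.floor_lt.1 h4
    push_cast at h6
    exact ⟨nonneg_of_mul_nonneg_right h5 hN', by nlinarith⟩

/-- A real-valued function that is constant on the intervals `[k/N, (k+1)/N)` can be sorted by
a bijective measure-preserving map. -/
lemma exists_sorting_bijection {N : ℕ} (hN : 0 < N) (a : ℤ → ℝ) :
    ∃ σ : unitInterval → unitInterval, IsMP σ ∧ Function.Bijective σ ∧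
      ∀ x y : unitInterval, (x : ℝ) < 1 → (y : ℝ) < 1 → σ x ≤ σ y →
        a ⌊N * (x : ℝ)⌋ ≤ a ⌊N * (y : ℝ)⌋ := by
  have hN' : (0 : ℝ) < N := by positivity
  let p : ℤ → Prop := fun k => 0 ≤ k ∧ k < N
  let e : Fin N ≃ {k : ℤ // p k} :=
    { toFun := fun i => ⟨i, by omega, by omega⟩
      invFun := fun k => ⟨k.1.toNat, by have := k.2.1; have := k.2.2; omega⟩
      left_inv := fun i => by ext; simp
      right_inv := fun k => by ext; simpa using k.2.1 }
  let s : Equiv.Perm (Fin N) := Tuple.sort fun i : Fin N => a i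
  have hs : Monotone ((fun i : Fin N => a i) ∘ s) := Tuple.monotone_sort _
  classical
  let τ : Equiv.Perm ℤ := Equiv.Perm.extendDomain s.symm e
  have hτe : ∀ i : Fin N, τ i = (s.symm i : ℕ) := fun i =>
    Equiv.Perm.extendDomain_apply_image s.symm e i
  have hτe' : ∀ i : Fin N, τ.symm i = (s i : ℕ) := fun i => by
    rw [Equiv.symm_apply_eq, hτe, Equiv.symm_apply_apply]
  have hfin : ∀ k : ℤ, 0 ≤ k → k < N → ∃ i : Fin N, k = i := fun k h0 h1 =>
    ⟨⟨k.toNat, by omega⟩, by simp [h0]⟩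
  have hτ : ∀ k : ℤ, 0 ≤ k → k < N → 0 ≤ τ k ∧ τ k < N := by
    intro k h0 h1
    obtain ⟨i, rfl⟩ := hfin k h0 h1
    rw [hτe]
    omega
  have hτ' : ∀ k : ℤ, 0 ≤ k → k < N → 0 ≤ τ.symm k ∧ τ.symm k < N := by
    intro k h0 h1
    obtain ⟨i, rfl⟩ := hfin k h0 h1
    rw [hτe']
    omega
  have hτN : τ N = N := Equiv.Perm.extendDomain_apply_not_subtype _ _ fun h => lt_irrefl _ h.2
  have hτN' : τ.symm N = N := by rw [Equiv.symm_apply_eq, hτN]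
  let σ : unitInterval → unitInterval := fun x =>
    ⟨intervalExchange N τ x, intervalExchange_mem_Icc hN hτ hτN x.2⟩
  let ρ : unitInterval → unitInterval := fun x =>
    ⟨intervalExchange N τ.symm x, intervalExchange_mem_Icc hN hτ' hτN' x.2⟩
  have hρσ : Function.LeftInverse ρ σ := fun x => Subtype.ext (intervalExchange_symm hN τ x)
  have hσρ : Function.RightInverse ρ σ := fun x =>
    Subtype.ext (intervalExchange_symm hN τ.symm x)
  have hσm : Measurable σ :=
    ((measurable_intervalExchange N τ).comp measurable_subtype_coe).subtype_mk
  have hpre : intervalExchange N τ ⁻¹' unitInterval = unitInterval := by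
    ext y
    refine ⟨fun h => ?_, intervalExchange_mem_Icc hN hτ hτN⟩
    rw [← intervalExchange_symm hN τ y]
    exact intervalExchange_mem_Icc hN hτ' hτN' h
  have hT : MeasurePreserving (intervalExchange N τ) (volume.restrict unitInterval)
      (volume.restrict unitInterval) := by
    have := (measurePreserving_intervalExchange hN τ).restrict_preimage
      (s := unitInterval) measurableSet_Icc
    rwa [hpre] at this
  refine ⟨σ, ⟨hσm, Measure.ext fun A hA => ?_⟩, ⟨hρσ.injective, hσρ.surjective⟩, ?_⟩
  · rw [Measure.map_apply hσm hA]
    have hB : MeasurableSet ((↑) '' A : Set ℝ) :=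
      unitInterval.measurableEmbedding_coe.measurableSet_image.2 hA
    have hA' : A = (↑) ⁻¹' ((↑) '' A : Set ℝ) :=
      (Set.preimage_image_eq _ Subtype.val_injective).symm
    have h1 := unitInterval.measurePreserving_coe.measure_preimage hB.nullMeasurableSet
    have h2 := (hT.comp unitInterval.measurePreserving_coe).measure_preimage
      hB.nullMeasurableSet
    rw [← hA'] at h1
    rw [h1, ← h2]
    conv_lhs => rw [hA']
    rfl
  · intro x y hx hy hxy
    have hfl : ∀ z : unitInterval, (z : ℝ) < 1 → ∃ i : Fin N, ⌊N * (z : ℝ)⌋ = i := fun z hz =>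
      hfin _ (Int.floor_nonneg.2 (mul_nonneg hN'.le z.2.1))
        (Int.floor_lt.2 (by push_cast; nlinarith))
    obtain ⟨i, hi⟩ := hfl x hx
    obtain ⟨j, hj⟩ := hfl y hy
    have hle : ⌊N * intervalExchange N τ x⌋ ≤ ⌊N * intervalExchange N τ y⌋ :=
      Int.floor_mono (mul_le_mul_of_nonneg_left hxy hN'.le)
    rw [floor_intervalExchange hN, floor_intervalExchange hN, hi, hj, hτe, hτe] at hle
    have := hs (show s.symm i ≤ s.symm j by exact_mod_cast hle)
    simpa [hi, hj] using this

/-! ### Approximation by bijective measure-preserving maps -/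

lemma volume_inter_unitInterval_le {φ σ : unitInterval → unitInterval} (hφ : IsMP φ)
    (hσ : IsMP σ) {B : Set unitInterval} {S T : Set ℝ} (hS : MeasurableSet S)
    (hT : MeasurableSet T) (h : ∀ x, x ∉ B → (σ x : ℝ) ∈ S → (φ x : ℝ) ∈ T) :
    volume (S ∩ unitInterval) ≤ volume B + volume (T ∩ unitInterval) := by
  have key : ∀ {ρ : unitInterval → unitInterval}, IsMP ρ → ∀ {S : Set ℝ}, MeasurableSet S →
      volume {x | (ρ x : ℝ) ∈ S} = volume (S ∩ unitInterval) := by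
    intro ρ hρ S hS
    rw [← Measure.restrict_apply hS,
      ← (unitInterval.measurePreserving_coe.comp hρ).measure_preimage hS.nullMeasurableSet]
    rfl
  rw [← key hσ hS, ← key hφ hT]
  refine (measure_mono fun x hx => ?_).trans (measure_union_le B {x | (φ x : ℝ) ∈ T})
  by_cases hB : x ∈ B
  · exact Or.inl hB
  · exact Or.inr (h x hB hx)

lemma exists_bijective_measure_dist_le {φ : unitInterval → unitInterval} (hφ : IsMP φ) {ε : ℝ}
    (hε : 0 < ε) : ∃ σ : unitInterval → unitInterval, IsMP σ ∧ Function.Bijective σ ∧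
      volume {x | ε < dist (σ x) (φ x)} ≤ ENNReal.ofReal ε := by
  set δ := ε / 5 with hδ
  have hδ0 : 0 < δ := by positivity
  have hφm : Measurable fun x => (φ x : ℝ) := measurable_subtype_coe.comp hφ.measurable
  have hint : Integrable (fun x => (φ x : ℝ)) (volume : Measure unitInterval) :=
    Integrable.of_bound hφm.aestronglyMeasurable 1
      (.of_forall fun x => by rw [Real.norm_of_nonneg (φ x).2.1]; exact (φ x).2.2)
  obtain ⟨g, hg, -⟩ := hint.exists_boundedContinuous_lintegral_sub_le
    (ε := ENNReal.ofReal δ * ENNReal.ofReal δ) (by simp [hδ0])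
  have hguc : UniformContinuous g := CompactSpace.uniformContinuous_of_continuous g.continuous
  obtain ⟨η, hη, hgη⟩ := Metric.uniformContinuous_iff.1 hguc δ hδ0
  obtain ⟨n, hn⟩ := exists_nat_one_div_lt hη
  have hNpos : (0 : ℝ) < (n + 1 : ℕ) := by positivity
  obtain ⟨σ, hσ, hσb, hσa⟩ := exists_sorting_bijection n.succ_pos
    fun k => g (Set.projIcc 0 1 zero_le_one (k / (n + 1 : ℕ)))
  set A : unitInterval → ℝ := fun x =>
    g (Set.projIcc 0 1 zero_le_one (⌊(n + 1 : ℕ) * (x : ℝ)⌋ / (n + 1 : ℕ)))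
  have hA : ∀ x : unitInterval, |A x - g x| < δ := by
    intro x
    refine hgη (lt_of_le_of_lt ?_ hn)
    have h1 := Int.floor_le ((n + 1 : ℕ) * (x : ℝ))
    have h2 := Int.lt_floor_add_one ((n + 1 : ℕ) * (x : ℝ))
    have h3 : (0 : ℝ) ≤ ⌊(n + 1 : ℕ) * (x : ℝ)⌋ := by
      exact_mod_cast Int.floor_nonneg.2 (mul_nonneg hNpos.le x.2.1)
    have h4 : (⌊(n + 1 : ℕ) * (x : ℝ)⌋ : ℝ) / (n + 1 : ℕ) ≤ x := by
      rw [div_le_iff₀ hNpos]; linarith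
    have h5 : (x : ℝ) - 1 / (n + 1 : ℕ) ≤ ⌊(n + 1 : ℕ) * (x : ℝ)⌋ / (n + 1 : ℕ) := by
      rw [le_div_iff₀ hNpos, sub_mul, one_div_mul_cancel hNpos.ne']; linarith
    have h6 : (⌊(n + 1 : ℕ) * (x : ℝ)⌋ : ℝ) / (n + 1 : ℕ) ∈ Set.Icc (0 : ℝ) 1 :=
      ⟨by positivity, h4.trans x.2.2⟩
    rw [Set.projIcc_of_mem _ h6, Subtype.dist_eq, Real.dist_eq, abs_le]
    push_cast at h4 h5 ⊢
    constructor <;> linarith [show (0 : ℝ) ≤ 1 / ((n : ℝ) + 1) by positivity]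
  set B : Set unitInterval := {x | ENNReal.ofReal δ ≤ ‖(φ x : ℝ) - g x‖ₑ} ∪ {1} with hB
  have hBvol : volume B ≤ ENNReal.ofReal δ := by
    refine (measure_union_le _ _).trans ?_
    rw [measure_singleton, add_zero]
    have h1 := mul_meas_ge_le_lintegral₀ (μ := (volume : Measure unitInterval))
      (f := fun x => ‖(φ x : ℝ) - g x‖ₑ)
      (hφm.sub g.continuous.measurable).enorm.aemeasurable (ENNReal.ofReal δ)
    exact (ENNReal.mul_le_mul_iff_right (by simp [hδ0]) ENNReal.ofReal_ne_top).1 (h1.trans hg)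
  have hBc : ∀ x, x ∉ B → (x : ℝ) < 1 ∧ |A x - φ x| < 2 * δ := by
    intro x hx
    simp only [hB, Set.mem_union, Set.mem_ofPred_eq, Set.mem_singleton_iff, not_or, not_le] at hx
    refine ⟨lt_of_le_of_ne x.2.2 fun h => hx.2 (Subtype.ext h), ?_⟩
    have h1 := hx.1
    rw [Real.enorm_eq_ofReal_abs, ENNReal.ofReal_lt_ofReal_iff hδ0] at h1
    have h2 := hA x
    rw [abs_lt] at *
    constructor <;> linarith
  refine ⟨σ, hσ, hσb, ?_⟩
  refine ((measure_mono fun x hx => ?_).trans hBvol).trans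
    (ENNReal.ofReal_le_ofReal (by linarith))
  by_contra hxB
  refine absurd hx (show ¬ ε < _ from not_lt.2 ?_)
  obtain ⟨hx1, hx2⟩ := hBc x hxB
  rw [abs_lt] at hx2
  have hup := volume_inter_unitInterval_le hφ hσ (B := B) (S := Set.Iic (σ x : ℝ))
    (T := Set.Iic (φ x + 4 * δ : ℝ)) measurableSet_Iic measurableSet_Iic (by
      intro y hyB hy
      obtain ⟨hy1, hy2⟩ := hBc y hyB
      have := hσa y x hy1 hx1 hy
      change A y ≤ A x at this
      rw [abs_lt] at hy2
      simp only [Set.mem_Iic]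
      linarith)
  have hlo := volume_inter_unitInterval_le hφ hσ (B := B) (S := Set.Ici (σ x : ℝ))
    (T := Set.Ici (φ x - 4 * δ : ℝ)) measurableSet_Ici measurableSet_Ici (by
      intro y hyB hy
      obtain ⟨hy1, hy2⟩ := hBc y hyB
      have := hσa x y hx1 hy1 hy
      change A x ≤ A y at this
      rw [abs_lt] at hy2
      simp only [Set.mem_Ici]
      linarith)
  have e1 : Set.Iic (σ x : ℝ) ∩ unitInterval = Set.Icc 0 (σ x : ℝ) := by
    ext y
    have := (σ x).2.2
    simp only [Set.mem_inter_iff, Set.mem_Iic, Set.mem_Icc]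
    grind
  have e2 : Set.Ici (σ x : ℝ) ∩ unitInterval = Set.Icc (σ x : ℝ) 1 := by
    ext y
    have := (σ x).2.1
    simp only [Set.mem_inter_iff, Set.mem_Ici, Set.mem_Icc]
    grind
  have e3 : Set.Iic (φ x + 4 * δ : ℝ) ∩ unitInterval ⊆ Set.Icc 0 (φ x + 4 * δ : ℝ) :=
    fun y hy => ⟨hy.2.1, hy.1⟩
  have e4 : Set.Ici (φ x - 4 * δ : ℝ) ∩ unitInterval ⊆ Set.Icc (φ x - 4 * δ : ℝ) 1 :=
    fun y hy => ⟨hy.1, hy.2.2⟩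
  have hφ0 := (φ x).2.1
  have hφ1 := (φ x).2.2
  have u1 := hup.trans (add_le_add hBvol (measure_mono e3))
  have u2 := hlo.trans (add_le_add hBvol (measure_mono e4))
  rw [e1, Real.volume_Icc, Real.volume_Icc, ← ENNReal.ofReal_add hδ0.le (by linarith),
    ENNReal.ofReal_le_ofReal_iff (by linarith)] at u1
  rw [e2, Real.volume_Icc, Real.volume_Icc, ← ENNReal.ofReal_add hδ0.le (by linarith),
    ENNReal.ofReal_le_ofReal_iff (by linarith)] at u2
  rw [Subtype.dist_eq, Real.dist_eq, abs_le]
  constructor <;> linarith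

/-- Every measure-preserving map is an a.e. limit of bijective measure-preserving maps. -/
lemma exists_bijective_seq_tendsto {φ : unitInterval → unitInterval} (hφ : IsMP φ) :
    ∃ σ : ℕ → unitInterval → unitInterval, (∀ n, IsMP (σ n)) ∧
      (∀ n, Function.Bijective (σ n)) ∧
      ∀ᵐ x, Tendsto (fun n => σ n x) atTop (𝓝 (φ x)) := by
  choose σ h1 h2 h3 using fun n : ℕ =>
    exists_bijective_measure_dist_le hφ (show (0 : ℝ) < (1 / 2) ^ n by positivity)
  refine ⟨σ, h1, h2, ?_⟩
  have hsum : ∑' n, volume {x | (1 / 2 : ℝ) ^ n < dist (σ n x) (φ x)} ≠ ∞ := by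
    refine ne_top_of_le_ne_top ?_ (ENNReal.tsum_le_tsum h3)
    rw [← ENNReal.ofReal_tsum_of_nonneg (fun n => by positivity) summable_geometric_two]
    exact ENNReal.ofReal_ne_top
  filter_upwards [ae_eventually_notMem hsum] with x hx
  rw [tendsto_iff_dist_tendsto_zero]
  refine squeeze_zero' (.of_forall fun n => dist_nonneg) ?_
    (tendsto_pow_atTop_nhds_zero_of_lt_one (by norm_num) (by norm_num : (1 / 2 : ℝ) < 1))
  filter_upwards [hx] with n hn using not_lt.1 hn

/-! ### Continuity of relabeling -/

lemma tendsto_lintegral_enorm_comp_sub {X : Type*} [TopologicalSpace X] [NormalSpace X]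
    [MeasurableSpace X] [BorelSpace X] {μ : Measure X} [IsFiniteMeasure μ] [μ.WeaklyRegular]
    {Φn : ℕ → X → X} {Φ : X → X} (hΦn : ∀ n, MeasurePreserving (Φn n) μ μ)
    (hΦ : MeasurePreserving Φ μ μ) (hlim : ∀ᵐ p ∂μ, Tendsto (fun n => Φn n p) atTop (𝓝 (Φ p)))
    {f : X → ℝ} (hfm : Measurable f) (hf : Integrable f μ) :
    Tendsto (fun n => ∫⁻ p, ‖f (Φn n p) - f (Φ p)‖ₑ ∂μ) atTop (𝓝 0) := by
  rw [ENNReal.tendsto_nhds_zero]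
  intro ε hε
  have hε3 : ε / 3 ≠ 0 := by simp [hε.ne']
  obtain ⟨g, hg, hgi⟩ := hf.exists_boundedContinuous_lintegral_sub_le hε3
  have hgm := g.continuous.measurable
  have hcont : Tendsto (fun n => ∫⁻ p, ‖g (Φn n p) - g (Φ p)‖ₑ ∂μ) atTop (𝓝 0) := by
    have := tendsto_lintegral_of_dominated_convergence (μ := μ)
      (F := fun n p => ‖g (Φn n p) - g (Φ p)‖ₑ) (f := fun _ => 0)
      (fun _ => ENNReal.ofReal (2 * ‖g‖))
      (fun n => ((hgm.comp (hΦn n).measurable).sub (hgm.comp hΦ.measurable)).enorm)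
      (fun n => .of_forall fun p => by
        simp only [← ofReal_norm]
        refine ENNReal.ofReal_le_ofReal ((norm_sub_le _ _).trans ?_)
        linarith [g.norm_coe_le_norm (Φn n p), g.norm_coe_le_norm (Φ p)])
      (by
        rw [lintegral_const]
        exact ENNReal.mul_ne_top ENNReal.ofReal_ne_top (measure_ne_top μ _))
      (by
        filter_upwards [hlim] with p hp
        have h1 := ((g.continuous.tendsto _).comp hp).sub_const (g (Φ p))
        simpa using h1.enorm)
    simpa using this
  filter_upwards [(ENNReal.tendsto_nhds_zero.1 hcont) (ε / 3) (pos_iff_ne_zero.2 hε3)] with n hn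
  have hm : Measurable fun p => ‖f p - g p‖ₑ := (hfm.sub hgm).enorm
  have h1 : ∫⁻ p, ‖f (Φn n p) - g (Φn n p)‖ₑ ∂μ ≤ ε / 3 := by
    rw [(hΦn n).lintegral_comp (f := fun p => ‖f p - g p‖ₑ) hm]
    exact hg
  have h2 : ∫⁻ p, ‖f (Φ p) - g (Φ p)‖ₑ ∂μ ≤ ε / 3 := by
    rw [hΦ.lintegral_comp (f := fun p => ‖f p - g p‖ₑ) hm]
    exact hg
  have m1 : Measurable fun p => ‖f (Φn n p) - g (Φn n p)‖ₑ := hm.comp (hΦn n).measurable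
  have m2 : Measurable fun p => ‖f (Φ p) - g (Φ p)‖ₑ := hm.comp hΦ.measurable
  calc ∫⁻ p, ‖f (Φn n p) - f (Φ p)‖ₑ ∂μ
      ≤ ∫⁻ p, (‖f (Φn n p) - g (Φn n p)‖ₑ + ‖g (Φn n p) - g (Φ p)‖ₑ)
          + ‖f (Φ p) - g (Φ p)‖ₑ ∂μ := by
        refine lintegral_mono fun p => ?_
        have e : f (Φn n p) - f (Φ p) = (f (Φn n p) - g (Φn n p)) + (g (Φn n p) - g (Φ p))
          - (f (Φ p) - g (Φ p)) := by ring
        rw [e]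
        exact enorm_sub_le.trans (by gcongr; exact enorm_add_le _ _)
    _ = (∫⁻ p, ‖f (Φn n p) - g (Φn n p)‖ₑ ∂μ + ∫⁻ p, ‖g (Φn n p) - g (Φ p)‖ₑ ∂μ)
          + ∫⁻ p, ‖f (Φ p) - g (Φ p)‖ₑ ∂μ := by
        rw [lintegral_add_right _ m2, lintegral_add_left m1]
    _ ≤ (ε / 3 + ε / 3) + ε / 3 := by gcongr
    _ = ε := ENNReal.add_thirds ε

lemma exists_subseq_ae_tendsto_comp {X : Type*} [TopologicalSpace X] [NormalSpace X]
    [MeasurableSpace X] [BorelSpace X] {μ : Measure X} [IsFiniteMeasure μ] [μ.WeaklyRegular]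
    {Φn : ℕ → X → X} {Φ : X → X} (hΦn : ∀ n, MeasurePreserving (Φn n) μ μ)
    (hΦ : MeasurePreserving Φ μ μ) (hlim : ∀ᵐ p ∂μ, Tendsto (fun n => Φn n p) atTop (𝓝 (Φ p)))
    {f : ℕ → X → ℝ} (hfm : ∀ k, Measurable (f k)) (hf : ∀ k, Integrable (f k) μ) :
    ∃ ns : ℕ → ℕ, StrictMono ns ∧ ∀ᵐ p ∂μ, ∀ k,
      Tendsto (fun j => f k (Φn (ns j) p)) atTop (𝓝 (f k (Φ p))) := by
  have hev : ∀ j : ℕ, ∀ᶠ n in atTop, ∀ k ∈ Finset.range (j + 1),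
      ∫⁻ p, ‖f k (Φn n p) - f k (Φ p)‖ₑ ∂μ ≤ ENNReal.ofReal ((1 / 2) ^ j) := fun j =>
    (Finset.eventually_all _).2 fun k _ => ENNReal.tendsto_nhds_zero.1
      (tendsto_lintegral_enorm_comp_sub hΦn hΦ hlim (hfm k) (hf k)) _ (by simp)
  obtain ⟨ns, hns, hle⟩ := extraction_forall_of_eventually hev
  refine ⟨ns, hns, ae_all_iff.2 fun k => ?_⟩
  have hmeas : ∀ j, Measurable fun p => ‖f k (Φn (ns (j + k)) p) - f k (Φ p)‖ₑ := fun j =>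
    (((hfm k).comp (hΦn _).measurable).sub ((hfm k).comp hΦ.measurable)).enorm
  have hsum : ∫⁻ p, ∑' j, ‖f k (Φn (ns (j + k)) p) - f k (Φ p)‖ₑ ∂μ ≠ ∞ := by
    rw [lintegral_tsum fun j => (hmeas j).aemeasurable]
    refine ne_top_of_le_ne_top (b := ∑' j : ℕ, ENNReal.ofReal ((1 / 2) ^ j)) ?_
      (ENNReal.tsum_le_tsum fun j => (hle (j + k) k (by simp)).trans
        (ENNReal.ofReal_le_ofReal (pow_le_pow_of_le_one (by norm_num) (by norm_num) (by omega))))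
    rw [← ENNReal.ofReal_tsum_of_nonneg (fun n => by positivity) summable_geometric_two]
    exact ENNReal.ofReal_ne_top
  filter_upwards [ae_lt_top (Measurable.tsum hmeas) hsum] with p hp
  rw [← tendsto_add_atTop_iff_nat k, tendsto_iff_edist_tendsto_0]
  simpa [edist_eq_enorm_sub] using ENNReal.tendsto_atTop_zero_of_tsum_ne_top hp.ne

/-- Countably many Borel sets suffice to test weak convergence of probability measures. -/
lemma exists_countable_weakTendsto_test (Z : Type*) [MeasurableSpace Z] [TopologicalSpace Z]
    [SecondCountableTopology Z] [OpensMeasurableSpace Z] :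
    ∃ G : ℕ → Set Z, (∀ k, MeasurableSet (G k)) ∧
      ∀ (μ : ℕ → Measure Z) (ν : Measure Z), (∀ n, IsProbabilityMeasure (μ n)) →
        IsProbabilityMeasure ν →
        (∀ k, Tendsto (fun n => (μ n).real (G k)) atTop (𝓝 (ν.real (G k)))) →
        WeakTendsto μ ν := by
  let 𝓑 := TopologicalSpace.countableBasis Z
  have h𝓑 : TopologicalSpace.IsTopologicalBasis 𝓑 := TopologicalSpace.isBasis_countableBasis Z
  let S : Set (Set Z) := Set.sInter '' {t | t.Finite ∧ t ⊆ 𝓑}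
  have hSc : S.Countable :=
    (Set.countable_ofPred_finite_subset (TopologicalSpace.countable_countableBasis Z)).image _
  have hSne : S.Nonempty := ⟨_, ∅, ⟨Set.finite_empty, Set.empty_subset _⟩, rfl⟩
  have hSpi : IsPiSystem S := by
    rintro _ ⟨s, ⟨hs, hs'⟩, rfl⟩ _ ⟨t, ⟨ht, ht'⟩, rfl⟩ -
    exact ⟨s ∪ t, ⟨hs.union ht, Set.union_subset hs' ht'⟩, Set.sInter_union s t⟩
  have hSm : ∀ s ∈ S, MeasurableSet s := by
    rintro _ ⟨t, ⟨ht, ht'⟩, rfl⟩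
    exact (ht.isOpen_sInter fun u hu => h𝓑.isOpen (ht' hu)).measurableSet
  obtain ⟨G, hG⟩ := hSc.exists_eq_range hSne
  refine ⟨G, fun k => hSm _ (hG ▸ Set.mem_range_self k), fun μ ν hμ hν h => ?_⟩
  have := hSpi.tendsto_probabilityMeasure_of_tendsto_of_mem (l := atTop)
    (μ := fun n => (⟨μ n, hμ n⟩ : ProbabilityMeasure Z)) (ν := ⟨ν, hν⟩) hSm
    (fun u hu x hx => by
      obtain ⟨v, hv, hxv, hvu⟩ := h𝓑.exists_subset_of_mem_open hx hu
      refine ⟨v, ⟨{v}, ⟨Set.finite_singleton v, by simpa using hv⟩, by simp⟩,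
        (h𝓑.isOpen hv).mem_nhds hxv, hvu⟩)
    (fun s hs => by
      obtain ⟨k, rfl⟩ := hG ▸ hs
      exact NNReal.tendsto_coe.1 (h k))
  exact fun f => ProbabilityMeasure.tendsto_iff_forall_integral_tendsto.1 this f

section Relabel

variable {Z : Type*} [MeasurableSpace Z]

lemma IsMP.prodMap {φ : unitInterval → unitInterval} (hφ : IsMP φ) :
    MeasurePreserving (fun p : Sq => (φ p.1, φ p.2)) :=
  MeasurePreserving.prod hφ hφ

lemma IsMP.comp {φ ψ : unitInterval → unitInterval} (hφ : IsMP φ) (hψ : IsMP ψ) :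
    IsMP (φ ∘ ψ) :=
  MeasurePreserving.comp hφ hψ

lemma IsProbGraphon.relabel {W : Sq → Measure Z} (hW : IsProbGraphon W)
    {φ : unitInterval → unitInterval} (hφ : IsMP φ) : IsProbGraphon (relabel W φ) :=
  ⟨fun A hA => (hW.1 A hA).comp hφ.prodMap.measurable, fun _ => hW.2 _⟩

lemma relabel_relabel (W : Sq → Measure Z) (φ ψ : unitInterval → unitInterval) :
    relabel (relabel W φ) ψ = relabel W (φ ∘ ψ) := rfl

lemma relabel_ae_congr (W : Sq → Measure Z) {φ ψ : unitInterval → unitInterval}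
    (h : φ =ᵐ[volume] ψ) : relabel W φ =ᵐ[(volume : Measure Sq)] relabel W ψ := by
  filter_upwards [Measure.quasiMeasurePreserving_fst.ae h,
    Measure.quasiMeasurePreserving_snd.ae h] with p h1 h2
  simp only [relabel, h1, h2]

/-- A smooth distance is continuous under a.e. convergence of the relabeling maps. -/
lemma Smooth.tendsto_relabel [TopologicalSpace Z] [SecondCountableTopology Z]
    [OpensMeasurableSpace Z] {d : (Sq → Measure Z) → (Sq → Measure Z) → ℝ} (hd : Smooth d)
    {U : Sq → Measure Z} (hU : IsProbGraphon U) {φn : ℕ → unitInterval → unitInterval}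
    {φ : unitInterval → unitInterval} (hφn : ∀ n, IsMP (φn n)) (hφ : IsMP φ)
    (hlim : ∀ᵐ x, Tendsto (fun n => φn n x) atTop (𝓝 (φ x))) :
    Tendsto (fun n => d (relabel U (φn n)) (relabel U φ)) atTop (𝓝 0) := by
  obtain ⟨G, hGm, hG⟩ := exists_countable_weakTendsto_test Z
  refine tendsto_of_subseq_tendsto fun ms hms => ?_
  have hlim' : ∀ᵐ p : Sq, Tendsto (fun n => (φn (ms n) p.1, φn (ms n) p.2)) atTop
      (𝓝 (φ p.1, φ p.2)) := by
    filter_upwards [Measure.quasiMeasurePreserving_fst.ae hlim,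
      Measure.quasiMeasurePreserving_snd.ae hlim] with p h1 h2
    exact (h1.comp hms).prodMk_nhds (h2.comp hms)
  have hfm : ∀ k, Measurable fun p => (U p).real (G k) := fun k =>
    (hU.1 _ (hGm k)).ennreal_toReal
  obtain ⟨ns, -, hns⟩ := exists_subseq_ae_tendsto_comp (fun n => (hφn (ms n)).prodMap)
    hφ.prodMap hlim' hfm (fun k => Integrable.of_bound (hfm k).aestronglyMeasurable 1
      (.of_forall fun p => by
        have := hU.2 p
        rw [Real.norm_of_nonneg measureReal_nonneg]
        exact measureReal_le_one))
  refine ⟨ns, hd _ _ (fun n => hU.relabel (hφn _)) (hU.relabel hφ) (hns.mono fun p hp => ?_)⟩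
  exact hG _ _ (fun n => hU.2 _) (hU.2 _) hp

end Relabel

/-! ### Sequential compactness of couplings -/

lemma isMP_of_ae_tendsto {φn : ℕ → unitInterval → unitInterval}
    {φ : unitInterval → unitInterval} (hφn : ∀ n, IsMP (φn n)) (hφ : Measurable φ)
    (hlim : ∀ᵐ x, Tendsto (fun n => φn n x) atTop (𝓝 (φ x))) : IsMP φ := by
  refine ⟨hφ, ?_⟩
  have : IsProbabilityMeasure ((volume : Measure unitInterval).map φ) :=
    Measure.isProbabilityMeasure_map hφ.aemeasurable
  refine ext_of_forall_integral_eq_of_IsFiniteMeasure fun f => ?_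
  have hfm := f.continuous.measurable
  rw [integral_map hφ.aemeasurable hfm.aestronglyMeasurable]
  have h1 : Tendsto (fun n => ∫ x, f (φn n x)) atTop (𝓝 (∫ x, f (φ x))) :=
    tendsto_integral_of_dominated_convergence (fun _ => ‖f‖)
      (fun n => (hfm.comp (hφn n).measurable).aestronglyMeasurable) (integrable_const _)
      (fun n => .of_forall fun x => f.norm_coe_le_norm _)
      (hlim.mono fun x hx => (f.continuous.tendsto _).comp hx)
  have h2 : ∀ n, ∫ x, f (φn n x) = ∫ x, f x := fun n => by
    rw [← integral_map (hφn n).measurable.aemeasurable hfm.aestronglyMeasurable, (hφn n).map_eq]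
  simp only [h2] at h1
  exact tendsto_nhds_unique h1 tendsto_const_nhds

/-- The quantile function of a probability measure on the unit interval. -/
lemma exists_monotone_measurePreserving (μ : Measure unitInterval) [IsProbabilityMeasure μ] :
    ∃ Q : unitInterval → unitInterval, Monotone Q ∧ MeasurePreserving Q volume μ := by
  have hcm : Measurable ((↑) : unitInterval → ℝ) := measurable_subtype_coe
  set ν : Measure ℝ := μ.map (↑) with hν
  have : IsProbabilityMeasure ν := Measure.isProbabilityMeasure_map hcm.aemeasurable
  set F := ProbabilityTheory.cdf ν with hF
  have hF1 : F 1 = 1 := by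
    rw [hF, ProbabilityTheory.cdf_eq_real, measureReal_def, hν,
      Measure.map_apply hcm measurableSet_Iic,
      Set.preimage_eq_univ_iff.2 (by rintro _ ⟨x, rfl⟩; exact x.2.2), measure_univ,
      ENNReal.toReal_one]
  let Q : unitInterval → unitInterval := fun u => sInf {t | (u : ℝ) ≤ F t}
  have hQ : ∀ u t, Q u ≤ t ↔ (u : ℝ) ≤ F t := by
    intro u t
    refine ⟨fun h => ?_, fun h => sInf_le h⟩
    rw [← F.iInf_Ioi_eq]
    refine le_ciInf fun r => ?_
    obtain ⟨r, hr⟩ := r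
    rcases le_or_gt r 1 with h1 | h1
    · have hr0 : r ∈ unitInterval := ⟨t.2.1.trans (le_of_lt hr), h1⟩
      obtain ⟨t', ht', htr⟩ := sInf_lt_iff.1 (lt_of_le_of_lt h (show t < ⟨r, hr0⟩ from hr))
      exact le_trans ht' (F.mono htr.le)
    · exact u.2.2.trans (hF1.symm.le.trans (F.mono h1.le))
  have hmono : Monotone Q := fun u v huv =>
    (hQ _ _).2 (le_trans (show (u : ℝ) ≤ v from huv) ((hQ _ _).1 le_rfl))
  refine ⟨Q, hmono, hmono.measurable, ?_⟩
  have : IsProbabilityMeasure ((volume : Measure unitInterval).map Q) :=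
    Measure.isProbabilityMeasure_map hmono.measurable.aemeasurable
  refine Measure.ext_of_Iic _ _ fun t => ?_
  rw [Measure.map_apply hmono.measurable measurableSet_Iic]
  have hFt : F t ∈ unitInterval :=
    ⟨ProbabilityTheory.cdf_nonneg ν t, ProbabilityTheory.cdf_le_one ν t⟩
  have h1 : Q ⁻¹' Set.Iic t = Set.Iic ⟨F t, hFt⟩ := by
    ext u
    exact hQ u t
  rw [h1, unitInterval.volume_Iic]
  simp only [hF, ProbabilityTheory.ofReal_cdf, hν]
  rw [Measure.map_apply hcm measurableSet_Iic]
  rfl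

/-- Helly's selection principle for monotone self-maps of the unit interval. -/
lemma exists_subseq_tendsto_of_monotone {Qn : ℕ → unitInterval → unitInterval}
    (hQn : ∀ n, Monotone (Qn n)) : ∃ (ns : ℕ → ℕ) (Q : unitInterval → unitInterval),
      StrictMono ns ∧ Monotone Q ∧
        ∀ᵐ u, Tendsto (fun n => Qn (ns n) u) atTop (𝓝 (Q u)) := by
  obtain ⟨D, hDc, hDd⟩ := TopologicalSpace.exists_countable_dense unitInterval
  have : Countable D := hDc.to_subtype
  obtain ⟨G, ns, hns, hG⟩ := CompactSpace.tendsto_subseq fun n (x : D) => Qn n x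
  rw [tendsto_pi_nhds] at hG
  have hGm : Monotone G := fun x y hxy =>
    le_of_tendsto_of_tendsto' (hG x) (hG y) fun n => hQn _ hxy
  let Q : unitInterval → unitInterval := fun u => sSup (G '' {x | (x : unitInterval) ≤ u})
  have hQ : Monotone Q := fun u v huv =>
    sSup_le_sSup (Set.image_mono fun x (hx : (x : unitInterval) ≤ u) => hx.trans huv)
  refine ⟨ns, Q, hns, hQ, ?_⟩
  have hnull : volume ({u | ¬ContinuousAt Q u} ∪ {0, 1}) = 0 :=
    (hQ.countable_not_continuousAt.union (Set.toFinite _).countable).measure_zero _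
  filter_upwards [measure_eq_zero_iff_ae_notMem.1 hnull] with u hu
  simp only [Set.mem_union, Set.mem_ofPred_eq, Set.mem_insert_iff, Set.mem_singleton_iff, not_or,
    not_not] at hu
  obtain ⟨hc, h0, h1⟩ := hu
  refine tendsto_order.2 ⟨fun v hv => ?_, fun v hv => ?_⟩
  · obtain ⟨l, hl, hlu⟩ := exists_Ioc_subset_of_mem_nhds (hc (Ioi_mem_nhds hv))
      ⟨0, unitInterval.pos_iff_ne_zero.2 h0⟩
    obtain ⟨w, hlw, hwu⟩ := exists_between hl
    obtain ⟨x, hxD, hwx, hxu⟩ := hDd.exists_between hwu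
    have hw : v < Q w := hlu ⟨hlw, hwu.le⟩
    have hQG : Q w ≤ G ⟨x, hxD⟩ := sSup_le (by
      rintro _ ⟨y, hy, rfl⟩
      exact hGm (show (y : unitInterval) ≤ x from le_trans hy hwx.le))
    filter_upwards [(hG ⟨x, hxD⟩).eventually (lt_mem_nhds (hw.trans_le hQG))] with n hn
    exact hn.trans_le (hQn _ hxu.le)
  · obtain ⟨r, hr, hru⟩ := exists_Ico_subset_of_mem_nhds (hc (Iio_mem_nhds hv))
      ⟨1, unitInterval.lt_one_iff_ne_one.2 h1⟩
    obtain ⟨w, huw, hwr⟩ := exists_between hr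
    obtain ⟨x, hxD, hux, hxw⟩ := hDd.exists_between huw
    have hw : Q w < v := hru ⟨huw.le, hwr⟩
    have hGQ : G ⟨x, hxD⟩ ≤ Q w := le_sSup ⟨_, hxw.le, rfl⟩
    filter_upwards [(hG ⟨x, hxD⟩).eventually (gt_mem_nhds (hGQ.trans_lt hw))] with n hn
    exact (hQn _ hux.le).trans_lt hn

/-- A continuous surjection of the unit interval onto the unit square, with a measurable right
inverse. -/
lemma exists_continuous_surjection_measurable_section :
    ∃ (h : unitInterval → Sq) (s : Sq → unitInterval), Continuous h ∧ Measurable s ∧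
      ∀ p, h (s p) = p := by
  obtain ⟨f, hfc, hfs⟩ := exists_nat_bool_continuous_surjective_of_compact Sq
  obtain ⟨g, hg⟩ := ContinuousMap.exists_restrict_eq isClosed_cantorSet
    (⟨f ∘ cantorSetHomeomorphNatToBool, hfc.comp cantorSetHomeomorphNatToBool.continuous⟩ :
      C(cantorSet, Sq))
  let h : unitInterval → Sq := fun x => g x
  have hc : Continuous h := g.continuous.comp continuous_subtype_val
  have hsurj : Function.Surjective h := by
    intro p
    obtain ⟨c, rfl⟩ := hfs p
    obtain ⟨x, rfl⟩ := cantorSetHomeomorphNatToBool.surjective c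
    exact ⟨⟨x, cantorSet_subset_unitInterval x.2⟩, DFunLike.congr_fun hg x⟩
  have hmem : ∀ p, sInf (h ⁻¹' {p}) ∈ h ⁻¹' {p} := fun p =>
    (isClosed_singleton.preimage hc).isCompact.sInf_mem (hsurj p)
  refine ⟨h, fun p => sInf (h ⁻¹' {p}), hc, measurable_of_Iic fun t => ?_, hmem⟩
  have : (fun p => sInf (h ⁻¹' {p})) ⁻¹' Set.Iic t = h '' Set.Iic t := by
    ext p
    constructor
    · exact fun hp => ⟨_, hp, hmem p⟩
    · rintro ⟨x, hx, rfl⟩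
      exact (sInf_le rfl : sInf (h ⁻¹' {h x}) ≤ x).trans hx
  rw [this]
  exact (isClosed_Iic.isCompact.image hc).isClosed.measurableSet

/-- Along a subsequence, the couplings `(id, σ n)` of Lebesgue measure with itself converge,
in the sense that they are represented by almost surely convergent pairs of maps. -/
lemma exists_convergent_couplings {σ : ℕ → unitInterval → unitInterval}
    (hσ : ∀ n, IsMP (σ n)) : ∃ (ns : ℕ → ℕ) (φn ψn : ℕ → unitInterval → unitInterval)
      (φ ψ : unitInterval → unitInterval), StrictMono ns ∧ (∀ n, IsMP (φn n)) ∧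
        (∀ n, IsMP (ψn n)) ∧ IsMP φ ∧ IsMP ψ ∧ (∀ n, σ (ns n) ∘ φn n =ᵐ[volume] ψn n) ∧
        (∀ᵐ x, Tendsto (fun n => φn n x) atTop (𝓝 (φ x))) ∧
        ∀ᵐ x, Tendsto (fun n => ψn n x) atTop (𝓝 (ψ x)) := by
  obtain ⟨h, s, hh, hs, hhs⟩ := exists_continuous_surjection_measurable_section
  have hγm : ∀ n, Measurable fun x => s (x, σ n x) := fun n =>
    hs.comp (measurable_id.prodMk (hσ n).measurable)
  have hex : ∀ n, ∃ Q : unitInterval → unitInterval, Monotone Q ∧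
      MeasurePreserving Q volume (volume.map fun x => s (x, σ n x)) := fun n =>
    have := Measure.isProbabilityMeasure_map (μ := (volume : Measure unitInterval))
      (hγm n).aemeasurable
    exists_monotone_measurePreserving _
  choose Qn hQn hQnm using hex
  obtain ⟨ns, Q, hns, hQ, hlim⟩ := exists_subseq_tendsto_of_monotone hQn
  have hh1 : Measurable fun x => (h x).1 := (measurable_fst.comp hh.measurable)
  have hh2 : Measurable fun x => (h x).2 := (measurable_snd.comp hh.measurable)
  have hfst : ∀ n, MeasurePreserving (fun x => (h x).1)
      (volume.map fun x => s (x, σ n x)) volume := fun n => by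
    refine ⟨hh1, ?_⟩
    have : ((fun x => (h x).1) ∘ fun x => s (x, σ n x)) = id :=
      funext fun x => by simp [hhs]
    rw [Measure.map_map hh1 (hγm n), this, Measure.map_id]
  have hsnd : ∀ n, MeasurePreserving (fun x => (h x).2)
      (volume.map fun x => s (x, σ n x)) volume := fun n => by
    refine ⟨hh2, ?_⟩
    have : ((fun x => (h x).2) ∘ fun x => s (x, σ n x)) = σ n :=
      funext fun x => by simp [hhs]
    rw [Measure.map_map hh2 (hγm n), this, (hσ n).map_eq]
  have h1 : ∀ n, IsMP fun x => (h (Qn (ns n) x)).1 := fun n => (hfst _).comp (hQnm _)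
  have h2 : ∀ n, IsMP fun x => (h (Qn (ns n) x)).2 := fun n => (hsnd _).comp (hQnm _)
  have l1 : ∀ᵐ x, Tendsto (fun n => (h (Qn (ns n) x)).1) atTop (𝓝 (h (Q x)).1) :=
    hlim.mono fun x hx => ((continuous_fst.comp hh).tendsto _).comp hx
  have l2 : ∀ᵐ x, Tendsto (fun n => (h (Qn (ns n) x)).2) atTop (𝓝 (h (Q x)).2) :=
    hlim.mono fun x hx => ((continuous_snd.comp hh).tendsto _).comp hx
  refine ⟨ns, _, _, _, _, hns, h1, h2, isMP_of_ae_tendsto h1 (hh1.comp hQ.measurable) l1,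
    isMP_of_ae_tendsto h2 (hh2.comp hQ.measurable) l2, fun n => ?_, l1, l2⟩
  refine (hQnm (ns n)).quasiMeasurePreserving.ae
    (p := fun x => σ (ns n) (h x).1 = (h x).2) ?_
  have hset : MeasurableSet {x | σ (ns n) (h x).1 = (h x).2} :=
    measurableSet_eq_fun ((hσ _).measurable.comp hh1) hh2
  exact (ae_map_iff (hγm _).aemeasurable hset).2 (.of_forall fun x => by simp [hhs])

/-! ### The unlabeled cut distance -/

lemma isMP_id : IsMP id := MeasurePreserving.id _

lemma IsMP.exists_inverse {σ : unitInterval → unitInterval} (hσ : IsMP σ)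
    (hb : Function.Bijective σ) :
    ∃ ρ : unitInterval → unitInterval, IsMP ρ ∧ Function.Bijective ρ ∧ σ ∘ ρ = id := by
  let e : unitInterval ≃ᵐ unitInterval :=
    { Equiv.ofBijective σ hb with
      measurable_toFun := hσ.measurable
      measurable_invFun := fun s hs => by
        have : (Equiv.ofBijective σ hb).symm ⁻¹' s = σ '' s :=
          ((Equiv.ofBijective σ hb).image_eq_preimage_symm s).symm
        exact this ▸ (hσ.measurable.measurableEmbedding hb.1).measurableSet_image.2 hs }
  exact ⟨e.symm, MeasurePreserving.symm e hσ, e.symm.bijective,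
    funext fun x => (Equiv.ofBijective σ hb).apply_symm_apply x⟩

section Distance

variable {Z : Type*} [MeasurableSpace Z]
  {d : (Sq → Measure Z) → (Sq → Measure Z) → ℝ}

lemma IsGraphonDist.tendsto (hd : IsGraphonDist d) {Un Wn : ℕ → Sq → Measure Z}
    {U W : Sq → Measure Z} (hUn : ∀ n, IsProbGraphon (Un n)) (hWn : ∀ n, IsProbGraphon (Wn n))
    (hU : IsProbGraphon U) (hW : IsProbGraphon W)
    (hUlim : Tendsto (fun n => d (Un n) U) atTop (𝓝 0))
    (hWlim : Tendsto (fun n => d (Wn n) W) atTop (𝓝 0)) :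
    Tendsto (fun n => d (Un n) (Wn n)) atTop (𝓝 (d U W)) := by
  obtain ⟨hsymm, -, htri, -⟩ := hd
  rw [tendsto_iff_dist_tendsto_zero]
  refine squeeze_zero (fun _ => dist_nonneg) (fun n => ?_)
    (by simpa using hUlim.add hWlim)
  rw [Real.dist_eq, abs_le]
  have h1 := htri _ _ _ (hUn n) hU (hWn n)
  have h2 := htri _ _ _ hU hW (hWn n)
  have h3 := htri _ _ _ hU (hUn n) hW
  have h4 := htri _ _ _ (hUn n) (hWn n) hW
  rw [hsymm _ _ hW (hWn n)] at h2
  rw [hsymm _ _ hU (hUn n)] at h3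
  constructor <;> linarith

lemma IsGraphonDist.eq_of_ae_eq (hd : IsGraphonDist d) {U V W : Sq → Measure Z}
    (hU : IsProbGraphon U) (hV : IsProbGraphon V) (hW : IsProbGraphon W)
    (h : V =ᵐ[(volume : Measure Sq)] W) : d U V = d U W := by
  obtain ⟨hsymm, -, htri, hzero⟩ := hd
  have h0 := (hzero _ _ hV hW).2 h
  have h1 := htri _ _ _ hU hV hW
  have h2 := htri _ _ _ hU hW hV
  rw [hsymm _ _ hW hV] at h2
  linarith

instance : Nonempty {φ : unitInterval → unitInterval // IsMP φ ∧ Function.Bijective φ} :=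
  ⟨⟨id, isMP_id, Function.bijective_id⟩⟩

lemma deltaCut_nonneg (hd : IsGraphonDist d) {U W : Sq → Measure Z} (hU : IsProbGraphon U)
    (hW : IsProbGraphon W) : 0 ≤ deltaCut d U W :=
  Real.iInf_nonneg fun φ => hd.2.1 _ _ hU (hW.relabel φ.2.1)

lemma deltaCut_le (hd : IsGraphonDist d) {U W : Sq → Measure Z} (hU : IsProbGraphon U)
    (hW : IsProbGraphon W) {φ : unitInterval → unitInterval} (hφ : IsMP φ)
    (hb : Function.Bijective φ) : deltaCut d U W ≤ d U (relabel W φ) :=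
  ciInf_le ⟨0, by rintro _ ⟨φ, rfl⟩; exact hd.2.1 _ _ hU (hW.relabel φ.2.1)⟩
    (⟨φ, hφ, hb⟩ : {φ : unitInterval → unitInterval // IsMP φ ∧ Function.Bijective φ})

lemma deltaCut_le_relabel (hd : IsGraphonDist d) (hinv : Invariant d) {U W : Sq → Measure Z}
    (hU : IsProbGraphon U) (hW : IsProbGraphon W) {φ ψ : unitInterval → unitInterval}
    (hφ : IsMP φ) (hφb : Function.Bijective φ) (hψ : IsMP ψ) (hψb : Function.Bijective ψ) :
    deltaCut d U W ≤ d (relabel U φ) (relabel W ψ) := by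
  obtain ⟨ρ, hρ, hρb, h⟩ := hφ.exists_inverse hφb
  refine (deltaCut_le hd hU hW (hψ.comp hρ) (hψb.comp hρb)).trans_eq ?_
  rw [← hinv _ _ (hU.relabel hφ) (hW.relabel hψ) ρ hρ hρb, relabel_relabel, relabel_relabel, h]
  rfl

lemma deltaCut_comm_le (hd : IsGraphonDist d) (hinv : Invariant d) {U W : Sq → Measure Z}
    (hU : IsProbGraphon U) (hW : IsProbGraphon W) : deltaCut d U W ≤ deltaCut d W U :=
  le_ciInf fun φ => by
    rw [hd.1 _ _ hW (hU.relabel φ.2.1)]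
    exact deltaCut_le_relabel hd hinv hU hW φ.2.1 φ.2.2 isMP_id Function.bijective_id

lemma deltaCut_triangle (hd : IsGraphonDist d) (hinv : Invariant d) {U V W : Sq → Measure Z}
    (hU : IsProbGraphon U) (hV : IsProbGraphon V) (hW : IsProbGraphon W) :
    deltaCut d U W ≤ deltaCut d U V + deltaCut d V W :=
  le_ciInf_add_ciInf fun φ ψ => by
    rw [← hinv _ _ hV (hW.relabel ψ.2.1) φ φ.2.1 φ.2.2]
    exact (deltaCut_le hd hU hW (ψ.2.1.comp φ.2.1) (ψ.2.2.comp φ.2.2)).trans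
      (hd.2.2.1 _ _ _ hU (hV.relabel φ.2.1) (hW.relabel (ψ.2.1.comp φ.2.1)))

variable [TopologicalSpace Z]

/-- An invariant smooth distance is invariant under all measure-preserving maps. -/
lemma Invariant.relabel_eq [SecondCountableTopology Z] [OpensMeasurableSpace Z]
    (hinv : Invariant d) (hd : IsGraphonDist d) (hs : Smooth d) {U W : Sq → Measure Z}
    (hU : IsProbGraphon U) (hW : IsProbGraphon W) {φ : unitInterval → unitInterval}
    (hφ : IsMP φ) : d (relabel U φ) (relabel W φ) = d U W := by
  obtain ⟨σ, hσ, hσb, hlim⟩ := exists_bijective_seq_tendsto hφ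
  have h := hd.tendsto (fun n => hU.relabel (hσ n)) (fun n => hW.relabel (hσ n))
    (hU.relabel hφ) (hW.relabel hφ) (hs.tendsto_relabel hU hσ hφ hlim)
    (hs.tendsto_relabel hW hσ hφ hlim)
  simp only [hinv U W hU hW _ (hσ _) (hσb _)] at h
  exact tendsto_nhds_unique h tendsto_const_nhds

lemma WeakIso.deltaCut_eq_zero [SecondCountableTopology Z] [OpensMeasurableSpace Z]
    (hd : IsGraphonDist d) (hinv : Invariant d) (hs : Smooth d) {U W : Sq → Measure Z}
    (hU : IsProbGraphon U) (hW : IsProbGraphon W) (h : WeakIso U W) : deltaCut d U W = 0 := by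
  obtain ⟨φ, ψ, hφ, hψ, heq⟩ := h
  obtain ⟨σ, hσ, hσb, hσlim⟩ := exists_bijective_seq_tendsto hφ
  obtain ⟨τ, hτ, hτb, hτlim⟩ := exists_bijective_seq_tendsto hψ
  have hlim := hd.tendsto (fun n => hU.relabel (hσ n)) (fun n => hW.relabel (hτ n))
    (hU.relabel hφ) (hW.relabel hψ) (hs.tendsto_relabel hU hσ hφ hσlim)
    (hs.tendsto_relabel hW hτ hψ hτlim)
  rw [(hd.2.2.2 _ _ (hU.relabel hφ) (hW.relabel hψ)).2 heq] at hlim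
  exact (ge_of_tendsto' hlim fun n =>
    deltaCut_le_relabel hd hinv hU hW (hσ n) (hσb n) (hτ n) (hτb n)).antisymm
      (deltaCut_nonneg hd hU hW)

lemma weakIso_of_deltaCut_eq_zero [SecondCountableTopology Z] [OpensMeasurableSpace Z]
    (hd : IsGraphonDist d) (hinv : Invariant d) (hs : Smooth d) {U W : Sq → Measure Z}
    (hU : IsProbGraphon U) (hW : IsProbGraphon W) (h : deltaCut d U W = 0) : WeakIso U W := by
  have hex : ∀ n : ℕ, ∃ σ : unitInterval → unitInterval, IsMP σ ∧
      d U (relabel W σ) < 1 / ((n : ℝ) + 1) := fun n => by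
    obtain ⟨σ, hσ⟩ := exists_lt_of_ciInf_lt (h.trans_lt Nat.one_div_pos_of_nat :
      deltaCut d U W < 1 / ((n : ℝ) + 1))
    exact ⟨σ, σ.2.1, hσ⟩
  choose σ hσ hlt using hex
  obtain ⟨ns, φn, ψn, φ, ψ, hns, hφn, hψn, hφ, hψ, heq, hφlim, hψlim⟩ :=
    exists_convergent_couplings hσ
  refine ⟨φ, ψ, hφ, hψ, (hd.2.2.2 _ _ (hU.relabel hφ) (hW.relabel hψ)).1 ?_⟩
  have hlim := hd.tendsto (fun n => hU.relabel (hφn n)) (fun n => hW.relabel (hψn n))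
    (hU.relabel hφ) (hW.relabel hψ) (hs.tendsto_relabel hU hφn hφ hφlim)
    (hs.tendsto_relabel hW hψn hψ hψlim)
  have hval : ∀ n, d (relabel U (φn n)) (relabel W (ψn n)) = d U (relabel W (σ (ns n))) :=
    fun n => by
      rw [← hinv.relabel_eq hd hs hU (hW.relabel (hσ (ns n))) (hφn n), relabel_relabel]
      exact (hd.eq_of_ae_eq (hU.relabel (hφn n)) (hW.relabel ((hσ _).comp (hφn n)))
        (hW.relabel (hψn n)) (relabel_ae_congr W (heq n))).symm
  simp only [hval] at hlim
  refine tendsto_nhds_unique hlim (squeeze_zero (fun n => hd.2.1 _ _ hU (hW.relabel (hσ _)))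
    (fun n => (hlt _).le) (tendsto_one_div_add_atTop_nhds_zero_nat.comp hns.tendsto_atTop))

end Distance

/-- **Weak isomorphism and the unlabeled cut distance.**
Let `d` be an invariant and smooth distance on the space `𝒲₁` of probability-graphons
and let `δ_□(U,W) = inf_{φ ∈ S_{[0,1]}} d(U, W^φ)`.  Then for probability-graphons
`U, W`: `δ_□(U,W) = 0` if and only if `U` and `W` are weakly isomorphic.
Consequently, `δ_□` is a distance on the quotient space `𝒲̃₁` of probability-graphons
modulo weak isomorphism: it is nonnegative, symmetric, satisfies the triangle
inequality, and separates weak isomorphism classes. -/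
theorem weak_isomorphism_iff_delta_zero
    {Z : Type*} [MeasurableSpace Z] [TopologicalSpace Z] [PolishSpace Z] [BorelSpace Z]
    (d : (Sq → Measure Z) → (Sq → Measure Z) → ℝ)
    (hdist : IsGraphonDist d) (hinv : Invariant d) (hsmooth : Smooth d) :
    (∀ U W : Sq → Measure Z, IsProbGraphon U → IsProbGraphon W →
      (deltaCut d U W = 0 ↔ WeakIso U W)) ∧
    (∀ U W : Sq → Measure Z, IsProbGraphon U → IsProbGraphon W →
      0 ≤ deltaCut d U W) ∧
    (∀ U W : Sq → Measure Z, IsProbGraphon U → IsProbGraphon W →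
      deltaCut d U W = deltaCut d W U) ∧
    (∀ U V W : Sq → Measure Z, IsProbGraphon U → IsProbGraphon V → IsProbGraphon W →
      deltaCut d U W ≤ deltaCut d U V + deltaCut d V W) := by
  exact ⟨fun U W hU hW => ⟨weakIso_of_deltaCut_eq_zero hdist hinv hsmooth hU hW,
      fun h => h.deltaCut_eq_zero hdist hinv hsmooth hU hW⟩,
    fun U W hU hW => deltaCut_nonneg hdist hU hW,
    fun U W hU hW => (deltaCut_comm_le hdist hinv hU hW).antisymm
      (deltaCut_comm_le hdist hinv hW hU),
    fun U V W hU hV hW => deltaCut_triangle hdist hinv hU hV hW⟩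

end PG
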